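/- arXiv:1702.04839 — 2 statements merged into one kernel-verified Lean document; each statement's English description precedes it below -/
import Mathlib

section
/- Let Y be a Delone set in ℝ with packing radius r > 0 and covering radius R > 0. Let ψ : ℕ → [0,∞) be any function and let α be a real number with α < −1. If the series ∑_{n=1}^∞ ψ(n) diverges, then for Lebesgue-almost every x ∈ ℝ there are infinitely many pairs (n, y) ∈ ℕ × Y satisfying |α^n x − y| ≤ ψ(n). -/
open MeasureTheory Set

open Metric Filter Topology

/-- The closed `δ`-neighbourhood of `Y`, as a union of closed intervals. -/
def fattening (Y : Set ℝ) (δ : ℝ) : Set ℝ := ⋃ y ∈ Y, closedBall y δ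

lemma mem_fattening {Y : Set ℝ} {δ x : ℝ} : x ∈ fattening Y δ ↔ ∃ y ∈ Y, |x - y| ≤ δ := by
  simp [fattening, Real.dist_eq]

section Separated

variable {Y : Set ℝ} {r : ℝ}

lemma card_mul_le_of_separated (hr : 0 < r)
    (hpack : ∀ y ∈ Y, ∀ y' ∈ Y, y ≠ y' → 2 * r ≤ |y - y'|)
    {F : Finset ℝ} (hFY : ↑F ⊆ Y) {c ρ : ℝ} (hρ : 0 ≤ ρ) (hF : ↑F ⊆ closedBall c ρ) :
    (F.card : ℝ) * r ≤ ρ + r := by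
  have hdisj : (F : Set ℝ).PairwiseDisjoint (fun y => ball y r) := by
    intro y hy y' hy' hne
    apply ball_disjoint_ball
    have := hpack y (hFY hy) y' (hFY hy') hne
    rw [Real.dist_eq]; linarith
  have h1 := measureReal_biUnion_finset (μ := volume) hdisj (fun _ _ => measurableSet_ball)
    (fun _ _ => measure_ball_lt_top.ne)
  simp only [Real.volume_real_ball hr.le, Finset.sum_const, nsmul_eq_mul] at h1
  have h2 : volume.real (⋃ y ∈ F, ball y r) ≤ volume.real (closedBall c (ρ + r)) := by
    refine measureReal_mono (iUnion₂_subset fun y hy => ?_) measure_closedBall_lt_top.ne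
    exact ball_subset_closedBall.trans (closedBall_subset_closedBall' (by
      have := mem_closedBall.1 (hF hy); linarith))
  rw [h1, Real.volume_real_closedBall (by linarith)] at h2
  linarith

lemma finite_inter_closedBall_of_separated (hr : 0 < r)
    (hpack : ∀ y ∈ Y, ∀ y' ∈ Y, y ≠ y' → 2 * r ≤ |y - y'|) (c ρ : ℝ) :
    (Y ∩ closedBall c ρ).Finite := by
  rcases lt_or_ge ρ 0 with hρ | hρ
  · simp [closedBall_eq_empty.2 hρ]
  by_contra hinf
  obtain ⟨n, hn⟩ := exists_nat_gt ((ρ + r) / r)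
  obtain ⟨F, hF, hcard⟩ := Set.Infinite.exists_subset_card_eq hinf n
  have := card_mul_le_of_separated hr hpack (hF.trans inter_subset_left) hρ
    (hF.trans inter_subset_right)
  rw [div_lt_iff₀ hr, ← hcard] at hn
  linarith

lemma countable_of_separated (hr : 0 < r)
    (hpack : ∀ y ∈ Y, ∀ y' ∈ Y, y ≠ y' → 2 * r ≤ |y - y'|) : Y.Countable := by
  have : Y = ⋃ n : ℕ, Y ∩ closedBall 0 n := by
    rw [← inter_iUnion, iUnion_closedBall_nat, inter_univ]
  rw [this]
  exact countable_iUnion fun n =>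
    (finite_inter_closedBall_of_separated hr hpack 0 n).countable

lemma measurableSet_fattening (hY : Y.Countable) (δ : ℝ) : MeasurableSet (fattening Y δ) :=
  MeasurableSet.biUnion hY fun _ _ => measurableSet_closedBall

lemma exists_finset_eq_inter_closedBall (hr : 0 < r)
    (hpack : ∀ y ∈ Y, ∀ y' ∈ Y, y ≠ y' → 2 * r ≤ |y - y'|) (c ρ : ℝ) :
    ∃ F : Finset ℝ, (F : Set ℝ) = Y ∩ closedBall c ρ :=
  ⟨(finite_inter_closedBall_of_separated hr hpack c ρ).toFinset, by simp⟩

lemma fattening_inter_closedBall_subset {F : Finset ℝ} {c ρ δ : ℝ}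
    (hF : (F : Set ℝ) = Y ∩ closedBall c (ρ + δ)) :
    fattening Y δ ∩ closedBall c ρ ⊆ ⋃ y ∈ F, closedBall y δ := by
  rintro x ⟨hx, hxc⟩
  obtain ⟨y, hy, hxy⟩ := mem_fattening.1 hx
  have hyF : y ∈ (F : Set ℝ) := by
    rw [hF]
    refine ⟨hy, ?_⟩
    rw [mem_closedBall, Real.dist_eq, abs_le] at *
    constructor <;> linarith
  exact mem_biUnion hyF (by rwa [mem_closedBall, Real.dist_eq])

lemma volume_fattening_inter_closedBall_le (hr : 0 < r)
    (hpack : ∀ y ∈ Y, ∀ y' ∈ Y, y ≠ y' → 2 * r ≤ |y - y'|)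
    {δ : ℝ} (hδ : 0 ≤ δ) (hδr : δ ≤ r) (c : ℝ) {ρ : ℝ} (hρ : 0 ≤ ρ) :
    volume.real (fattening Y δ ∩ closedBall c ρ) ≤ 2 * δ * (ρ / r + 2) := by
  obtain ⟨F, hF⟩ := exists_finset_eq_inter_closedBall hr hpack c (ρ + δ)
  have hcard := card_mul_le_of_separated hr hpack (F := F) (hF ▸ inter_subset_left)
    (by linarith : 0 ≤ ρ + δ) (hF ▸ inter_subset_right)
  have hcard' : (F.card : ℝ) ≤ ρ / r + 2 := by
    rw [← le_div_iff₀ hr] at hcard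
    refine hcard.trans ?_
    rw [div_add' _ _ _ hr.ne']
    exact div_le_div_of_nonneg_right (by linarith) hr.le
  calc volume.real (fattening Y δ ∩ closedBall c ρ)
      ≤ volume.real (⋃ y ∈ F, closedBall y δ) :=
        measureReal_mono (fattening_inter_closedBall_subset hF)
          ((measure_biUnion_lt_top F.finite_toSet fun _ _ => measure_closedBall_lt_top).ne)
    _ ≤ ∑ y ∈ F, volume.real (closedBall y δ) := measureReal_biUnion_finset_le _ _
    _ = 2 * δ * F.card := by
        simp [Real.volume_real_closedBall hδ, mul_comm]
    _ ≤ 2 * δ * (ρ / r + 2) := by gcongr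

lemma le_volume_fattening_inter_closedBall {R : ℝ} (hr : 0 < r) (hR : 0 < R)
    (hpack : ∀ y ∈ Y, ∀ y' ∈ Y, y ≠ y' → 2 * r ≤ |y - y'|)
    (hcov : ∀ x : ℝ, ∃ y ∈ Y, |x - y| ≤ R)
    {δ : ℝ} (hδ : 0 ≤ δ) (hδr : δ < r) (c : ℝ) {ρ : ℝ} (hρ : 2 * (r + R) ≤ ρ) :
    δ * ρ / R ≤ volume.real (fattening Y δ ∩ closedBall c ρ) := by
  obtain ⟨F, hF⟩ := exists_finset_eq_inter_closedBall hr hpack c (ρ - δ)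
  have hmem : ∀ y ∈ F, y ∈ Y ∩ closedBall c (ρ - δ) := fun y hy => hF ▸ Finset.mem_coe.2 hy
  have hcover : closedBall c (ρ - δ - R) ⊆ ⋃ y ∈ F, closedBall y R := by
    intro x hx
    obtain ⟨y, hy, hxy⟩ := hcov x
    have hyF : y ∈ (F : Set ℝ) := by
      rw [hF]
      refine ⟨hy, ?_⟩
      rw [mem_closedBall, Real.dist_eq, abs_le] at *
      constructor <;> linarith
    exact mem_biUnion hyF (by rwa [mem_closedBall, Real.dist_eq])
  have hcard : ρ / 2 ≤ R * F.card := by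
    have h := (measureReal_mono (μ := volume) hcover
      ((measure_biUnion_lt_top F.finite_toSet fun _ _ => measure_closedBall_lt_top).ne)).trans
      (measureReal_biUnion_finset_le _ _)
    rw [Real.volume_real_closedBall (by linarith)] at h
    simp only [Real.volume_real_closedBall hR.le, Finset.sum_const, nsmul_eq_mul] at h
    linarith
  have hdisj : (F : Set ℝ).PairwiseDisjoint (fun y => closedBall y δ) := by
    intro y hy y' hy' hne
    apply closedBall_disjoint_closedBall
    have := hpack y (hmem y hy).1 y' (hmem y' hy').1 hne
    rw [Real.dist_eq]; linarith
  calc δ * ρ / R ≤ 2 * δ * F.card := by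
        rw [div_le_iff₀ hR]
        nlinarith [mul_le_mul_of_nonneg_left hcard hδ]
    _ = volume.real (⋃ y ∈ F, closedBall y δ) := by
        rw [measureReal_biUnion_finset hdisj (fun _ _ => measurableSet_closedBall)
          (fun _ _ => measure_closedBall_lt_top.ne)]
        simp [Real.volume_real_closedBall hδ, mul_comm]
    _ ≤ volume.real (fattening Y δ ∩ closedBall c ρ) := by
        refine measureReal_mono (iUnion₂_subset fun y hy => subset_inter ?_ ?_)
          (measure_ne_top_of_subset inter_subset_right measure_closedBall_lt_top.ne)
        · exact subset_biUnion_of_mem (u := fun y => closedBall y δ) (hmem y hy).1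
        · exact closedBall_subset_closedBall' (by
            have := mem_closedBall.1 (hmem y hy).2; linarith)

end Separated

lemma volume_real_preimage_mul_left {a : ℝ} (ha : a ≠ 0) (s : Set ℝ) :
    volume.real ((fun x => a * x) ⁻¹' s) = |a|⁻¹ * volume.real s := by
  rw [measureReal_def, Real.volume_preimage_mul_left ha, ENNReal.toReal_mul,
    ENNReal.toReal_ofReal (abs_nonneg _), abs_inv, measureReal_def]

lemma preimage_mul_left_closedBall {a : ℝ} (ha : a ≠ 0) (c ρ : ℝ) :
    (fun x => a * x) ⁻¹' closedBall (a * c) (|a| * ρ) = closedBall c ρ := by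
  ext x
  simp only [mem_preimage, mem_closedBall, Real.dist_eq, ← mul_sub, abs_mul]
  exact mul_le_mul_iff_right₀ (abs_pos.2 ha)

lemma volume_preimage_fattening_inter_closedBall {a : ℝ} (ha : a ≠ 0) (Y : Set ℝ) (δ c ρ : ℝ) :
    volume.real ((fun x => a * x) ⁻¹' fattening Y δ ∩ closedBall c ρ) =
      |a|⁻¹ * volume.real (fattening Y δ ∩ closedBall (a * c) (|a| * ρ)) := by
  rw [← volume_real_preimage_mul_left ha, preimage_inter, preimage_mul_left_closedBall ha]

lemma volume_preimage_fattening_inter_le {Y : Set ℝ} {r : ℝ} (hr : 0 < r)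
    (hpack : ∀ y ∈ Y, ∀ y' ∈ Y, y ≠ y' → 2 * r ≤ |y - y'|)
    {a b : ℝ} (ha : a ≠ 0) (hb : b ≠ 0) {δ ε : ℝ} (hδ : 0 ≤ δ) (hδr : δ ≤ r)
    (hε : 0 ≤ ε) (hεr : ε ≤ r) (c : ℝ) {ρ : ℝ} (hρ : 2 * r ≤ |a| * ρ) :
    volume.real ((fun x => a * x) ⁻¹' fattening Y δ ∩ (fun x => b * x) ⁻¹' fattening Y ε
      ∩ closedBall c ρ) ≤ 4 * ρ / r * (δ * ε / r + 2 * ε * (|a| / |b|)) := by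
  have ha' := abs_pos.2 ha
  have hb' := abs_pos.2 hb
  obtain ⟨F, hF⟩ := exists_finset_eq_inter_closedBall hr hpack (a * c) (|a| * ρ + δ)
  have hcard := card_mul_le_of_separated hr hpack (F := F) (hF ▸ inter_subset_left)
    (by linarith : 0 ≤ |a| * ρ + δ) (hF ▸ inter_subset_right)
  have hcard' : (F.card : ℝ) ≤ 2 * (|a| * ρ) / r := by
    rw [le_div_iff₀ hr]
    linarith
  have hsub : (fun x => a * x) ⁻¹' fattening Y δ ∩ (fun x => b * x) ⁻¹' fattening Y ε
      ∩ closedBall c ρ ⊆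
      ⋃ y ∈ F, (fun x => b * x) ⁻¹' fattening Y ε ∩ closedBall (a⁻¹ * y) (|a|⁻¹ * δ) := by
    rintro x ⟨⟨hxa, hxb⟩, hx⟩
    rw [← preimage_mul_left_closedBall ha] at hx
    obtain ⟨y, hy, hxy⟩ := mem_iUnion₂.1 (fattening_inter_closedBall_subset hF ⟨hxa, hx⟩)
    refine mem_iUnion₂.2 ⟨y, hy, hxb, ?_⟩
    rw [← preimage_mul_left_closedBall ha, mul_inv_cancel_left₀ ha,
      mul_inv_cancel_left₀ ha'.ne']
    exact hxy
  calc _ ≤ volume.real (⋃ y ∈ F, (fun x => b * x) ⁻¹' fattening Y ε ∩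
            closedBall (a⁻¹ * y) (|a|⁻¹ * δ)) :=
        measureReal_mono hsub ((measure_biUnion_lt_top F.finite_toSet fun _ _ =>
          measure_lt_top_of_subset inter_subset_right measure_closedBall_lt_top.ne).ne)
    _ ≤ ∑ y ∈ F, volume.real ((fun x => b * x) ⁻¹' fattening Y ε ∩
            closedBall (a⁻¹ * y) (|a|⁻¹ * δ)) := measureReal_biUnion_finset_le _ _
    _ ≤ ∑ y ∈ F, |b|⁻¹ * (2 * ε * (|b| * (|a|⁻¹ * δ) / r + 2)) := by
        refine Finset.sum_le_sum fun y _ => ?_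
        rw [volume_preimage_fattening_inter_closedBall hb]
        gcongr
        exact volume_fattening_inter_closedBall_le hr hpack hε hεr _ (by positivity)
    _ = F.card * (|b|⁻¹ * (2 * ε * (|b| * (|a|⁻¹ * δ) / r + 2))) := by simp
    _ ≤ 2 * (|a| * ρ) / r * (|b|⁻¹ * (2 * ε * (|b| * (|a|⁻¹ * δ) / r + 2))) := by gcongr
    _ = 4 * ρ / r * (δ * ε / r + 2 * ε * (|a| / |b|)) := by
        field_simp
        ring

/-- The Chung–Erdős inequality. -/
lemma sq_sum_measureReal_le {X ι : Type*} [MeasurableSpace X] (μ : Measure X) [IsFiniteMeasure μ]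
    (s : Finset ι) {A : ι → Set X} (hA : ∀ i ∈ s, MeasurableSet (A i))
    {E : Set X} (hE : MeasurableSet E) (hAE : ∀ i ∈ s, A i ⊆ E) :
    (∑ i ∈ s, μ.real (A i)) ^ 2 ≤ μ.real E * ∑ i ∈ s, ∑ j ∈ s, μ.real (A i ∩ A j) := by
  have hint : ∀ {B : Set X}, MeasurableSet B → Integrable (B.indicator (1 : X → ℝ)) μ :=
    fun hB => (integrable_const 1).indicator hB
  have key : ∀ t : ℝ, 0 ≤ μ.real E * (t * t) + (-2 * ∑ i ∈ s, μ.real (A i)) * t +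
      ∑ i ∈ s, ∑ j ∈ s, μ.real (A i ∩ A j) := by
    intro t
    have hpt : ∀ x, (t * E.indicator (1 : X → ℝ) x - ∑ i ∈ s, (A i).indicator 1 x) ^ 2 =
        (t * t) * E.indicator (1 : X → ℝ) x + (-2 * t) * ∑ i ∈ s, (A i).indicator (1 : X → ℝ) x +
          ∑ i ∈ s, ∑ j ∈ s, (A i ∩ A j).indicator (1 : X → ℝ) x := by
      intro x
      have h1 : ∑ i ∈ s, ∑ j ∈ s, (A i ∩ A j).indicator (1 : X → ℝ) x =
          (∑ i ∈ s, (A i).indicator (1 : X → ℝ) x) ^ 2 := by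
        simp only [inter_indicator_one, Pi.mul_apply, sq, Finset.sum_mul_sum]
      have h2 : E.indicator (1 : X → ℝ) x * ∑ i ∈ s, (A i).indicator (1 : X → ℝ) x =
          ∑ i ∈ s, (A i).indicator (1 : X → ℝ) x := by
        rw [Finset.mul_sum]
        refine Finset.sum_congr rfl fun i hi => ?_
        by_cases hx : x ∈ A i
        · simp [hx, hAE i hi hx]
        · simp [hx]
      have h3 : E.indicator (1 : X → ℝ) x ^ 2 = E.indicator (1 : X → ℝ) x := by
        by_cases hx : x ∈ E <;> simp [hx]
      rw [h1]
      linear_combination t ^ 2 * h3 - 2 * t * h2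
    have h0 : 0 ≤ ∫ x, (t * E.indicator (1 : X → ℝ) x - ∑ i ∈ s, (A i).indicator 1 x) ^ 2 ∂μ :=
      integral_nonneg fun x => sq_nonneg _
    have hAA : ∀ i ∈ s, ∀ j ∈ s, Integrable ((A i ∩ A j).indicator (1 : X → ℝ)) μ :=
      fun i hi j hj => hint ((hA i hi).inter (hA j hj))
    have hi1 : Integrable (fun x => (t * t) * E.indicator (1 : X → ℝ) x) μ :=
      (hint hE).const_mul _
    have hi2 : Integrable (fun x => (-2 * t) * ∑ i ∈ s, (A i).indicator (1 : X → ℝ) x) μ :=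
      (integrable_finsetSum s fun i hi => hint (hA i hi)).const_mul _
    have hi3 : Integrable (fun x => ∑ i ∈ s, ∑ j ∈ s, (A i ∩ A j).indicator (1 : X → ℝ) x) μ :=
      integrable_finsetSum s fun i hi => integrable_finsetSum s fun j hj => hAA i hi j hj
    have hi12 : Integrable (fun x => (t * t) * E.indicator (1 : X → ℝ) x +
        (-2 * t) * ∑ i ∈ s, (A i).indicator (1 : X → ℝ) x) μ := hi1.add hi2
    simp_rw [hpt] at h0
    rw [integral_add hi12 hi3, integral_add hi1 hi2, integral_const_mul,
      integral_const_mul, integral_finsetSum s fun i hi => hint (hA i hi),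
      integral_finsetSum s fun i hi => integrable_finsetSum s fun j hj => hAA i hi j hj,
      integral_indicator_one hE,
      Finset.sum_congr rfl fun i hi => integral_indicator_one (hA i hi),
      Finset.sum_congr rfl fun i hi => (integral_finsetSum s fun j hj => hAA i hi j hj).trans
        (Finset.sum_congr rfl fun j hj =>
          integral_indicator_one ((hA i hi).inter (hA j hj)))] at h0
    linarith
  have := discrim_le_zero key
  rw [discrim] at this
  linarith

/-- A measurable set that fills a fixed proportion of every closed ball has full measure. -/
lemma ae_mem_of_forall_le_volume_inter_closedBall {E : Set ℝ} (hE : MeasurableSet E) {κ : ℝ}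
    (hκ : 0 < κ) (h : ∀ c ρ : ℝ, 0 < ρ → κ * ρ ≤ volume.real (E ∩ closedBall c ρ)) :
    ∀ᵐ x : ℝ, x ∈ E := by
  filter_upwards [Besicovitch.ae_tendsto_measure_inter_div_of_measurableSet volume hE] with x hx
  by_contra hxE
  rw [indicator_of_notMem hxE] at hx
  have hlim := (ENNReal.tendsto_toReal ENNReal.zero_ne_top).comp hx
  have hle : ∀ᶠ ρ in 𝓝[>] (0 : ℝ),
      κ / 2 ≤ (ENNReal.toReal ∘ fun ρ => volume (E ∩ closedBall x ρ) /
        volume (closedBall x ρ)) ρ := by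
    filter_upwards [self_mem_nhdsWithin] with ρ hρ
    have hρ : 0 < ρ := hρ
    rw [Function.comp_apply, ENNReal.toReal_div, ← measureReal_def, ← measureReal_def,
      Real.volume_real_closedBall hρ.le, le_div_iff₀ (by positivity)]
    linarith [h x ρ hρ]
  have := ge_of_tendsto hlim hle
  simp at this
  linarith

lemma sum_sum_mul_pow_sub_le {q : ℝ} (hq0 : 0 ≤ q) (hq : q < 1) (s : Finset ℕ) {ψ : ℕ → ℝ}
    (hψ : ∀ n, 0 ≤ ψ n) :
    ∑ n ∈ s, ∑ m ∈ s, (if m ≤ n then ψ n * q ^ (n - m) else 0) ≤ (1 - q)⁻¹ * ∑ n ∈ s, ψ n := by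
  rw [Finset.mul_sum]
  refine Finset.sum_le_sum fun n _ => ?_
  calc ∑ m ∈ s, (if m ≤ n then ψ n * q ^ (n - m) else 0)
      = ∑ m ∈ s with m ≤ n, ψ n * q ^ (n - m) := (Finset.sum_filter _ _).symm
    _ ≤ ∑ m ∈ Finset.range (n + 1), ψ n * q ^ (n - m) := by
        refine Finset.sum_le_sum_of_subset_of_nonneg (fun m hm => ?_) fun m _ _ =>
          mul_nonneg (hψ n) (pow_nonneg hq0 _)
        simp only [Finset.mem_filter, Finset.mem_range] at hm ⊢
        omega
    _ = ψ n * ∑ m ∈ Finset.range (n + 1), q ^ m := by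
        rw [← Finset.mul_sum, ← Finset.sum_range_reflect (fun m => q ^ m)]
        simp
    _ ≤ ψ n * (1 - q)⁻¹ := by
        refine mul_le_mul_of_nonneg_left ?_ (hψ n)
        rw [← tsum_geometric_of_lt_one hq0 hq]
        exact (summable_geometric_of_lt_one hq0 hq).sum_le_tsum _ fun m _ => pow_nonneg hq0 m
    _ = (1 - q)⁻¹ * ψ n := mul_comm _ _

lemma not_summable_min {ψ : ℕ → ℝ} (hψ : ¬ Summable ψ) {δ : ℝ} (hδ : 0 < δ) :
    ¬ Summable fun n => min (ψ n) δ := by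
  intro h
  refine hψ ((summable_congr_atTop ?_).1 h)
  filter_upwards [h.tendsto_atTop_zero.eventually_lt_const hδ] with n hn
  rcases min_lt_iff.1 hn with h1 | h1
  · exact min_eq_left h1.le
  · exact absurd h1 (lt_irrefl δ)

lemma exists_one_le_sum_Ico {ψ : ℕ → ℝ} (h0 : ∀ n, 0 ≤ ψ n) (hψ : ¬ Summable ψ) (N : ℕ) :
    ∃ M, 1 ≤ ∑ n ∈ Finset.Ico N M, ψ n := by
  have h := (not_summable_iff_tendsto_nat_atTop_of_nonneg fun n => h0 (n + N)).1
    (mt (summable_nat_add_iff N).1 hψ)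
  obtain ⟨k, hk⟩ := (h.eventually_ge_atTop 1).exists
  refine ⟨N + k, ?_⟩
  rw [Finset.sum_Ico_eq_sum_range]
  simpa [add_comm] using hk

section Delone

variable {Y : Set ℝ} {r R α : ℝ} {ψ : ℕ → ℝ}

lemma volume_inter_approx_le (hr : 0 < r)
    (hpack : ∀ y ∈ Y, ∀ y' ∈ Y, y ≠ y' → 2 * r ≤ |y - y'|)
    (h0 : ∀ n, 0 ≤ ψ n) (hψr : ∀ n, ψ n < r) (hα : 1 < |α|) (c : ℝ) {ρ : ℝ}
    {m n : ℕ} (hmn : m ≤ n) (hm : 2 * r ≤ |α| ^ m * ρ) :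
    volume.real ((fun x => α ^ m * x) ⁻¹' fattening Y (ψ m) ∩
      (fun x => α ^ n * x) ⁻¹' fattening Y (ψ n) ∩ closedBall c ρ) ≤
      4 * ρ / r * (ψ m * ψ n / r + 2 * (ψ n * |α|⁻¹ ^ (n - m))) := by
  have hα0 : α ≠ 0 := abs_pos.1 (by linarith)
  have h := volume_preimage_fattening_inter_le hr hpack (pow_ne_zero m hα0) (pow_ne_zero n hα0)
    (h0 m) (hψr m).le (h0 n) (hψr n).le c (ρ := ρ) (by rwa [abs_pow])
  refine h.trans_eq ?_
  have : |α ^ m| / |α ^ n| = |α|⁻¹ ^ (n - m) := by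
    rw [abs_pow, abs_pow, inv_pow, pow_sub₀ _ (by positivity) hmn, mul_inv, inv_inv, mul_comm,
      div_eq_mul_inv]
  rw [this, mul_assoc 2 (ψ n)]

/-- Uniformly over all intervals, the tail unions of the approximation sets fill a fixed
proportion of the interval. -/
lemma le_volume_iUnion_approx_inter (hr : 0 < r) (hR : 0 < R)
    (hpack : ∀ y ∈ Y, ∀ y' ∈ Y, y ≠ y' → 2 * r ≤ |y - y'|)
    (hcov : ∀ x : ℝ, ∃ y ∈ Y, |x - y| ≤ R)
    (h0 : ∀ n, 0 ≤ ψ n) (hψr : ∀ n, ψ n < r) (hα : 1 < |α|) (hdiv : ¬ Summable ψ)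
    (N : ℕ) (c : ℝ) {ρ : ℝ} (hρ : 0 < ρ) :
    (R ^ 2 * (4 / r * (1 / r + 4 * (1 - |α|⁻¹)⁻¹)))⁻¹ * ρ ≤
      volume.real ((⋃ n ≥ N, (fun x => α ^ n * x) ⁻¹' fattening Y (ψ n)) ∩ closedBall c ρ) := by
  have hα0 : α ≠ 0 := abs_pos.1 (by linarith)
  have hq0 : 0 ≤ |α|⁻¹ := by positivity
  have hq : |α|⁻¹ < 1 := inv_lt_one_of_one_lt₀ hα
  have hD : 0 < (1 - |α|⁻¹)⁻¹ := inv_pos.2 (by linarith)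
  set D := (1 - |α|⁻¹)⁻¹
  set A : ℕ → Set ℝ := fun n => (fun x => α ^ n * x) ⁻¹' fattening Y (ψ n)
  have hAm : ∀ n, MeasurableSet (A n) := fun n =>
    measurableSet_fattening (countable_of_separated hr hpack) _ |>.preimage
      (measurable_const_mul _)
  set E := ⋃ n ≥ N, A n
  have hEm : MeasurableSet E := MeasurableSet.iUnion fun n => MeasurableSet.iUnion fun _ => hAm n
  obtain ⟨N₁, hN₁⟩ := pow_unbounded_of_one_lt (2 * (r + R) / ρ) hα
  have hlarge : ∀ n ≥ N₁, 2 * (r + R) ≤ |α| ^ n * ρ := by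
    intro n hn
    rw [← div_le_iff₀ hρ]
    exact hN₁.le.trans (pow_le_pow_right₀ hα.le hn)
  obtain ⟨M, hM⟩ := exists_one_le_sum_Ico h0 hdiv (max N N₁)
  set s := Finset.Ico (max N N₁) M
  set S := ∑ n ∈ s, ψ n
  have hsN : ∀ n ∈ s, N ≤ n := fun n hn => (le_max_left _ _).trans (Finset.mem_Ico.1 hn).1
  have hsl : ∀ n ∈ s, 2 * (r + R) ≤ |α| ^ n * ρ := fun n hn =>
    hlarge n ((le_max_right _ _).trans (Finset.mem_Ico.1 hn).1)
  have : IsFiniteMeasure (volume.restrict (closedBall c ρ)) :=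
    ⟨by simpa using measure_closedBall_lt_top (μ := volume) (x := c) (r := ρ)⟩
  have hsq := sq_sum_measureReal_le (volume.restrict (closedBall c ρ)) s
    (fun n _ => hAm n) hEm (fun n hn => subset_biUnion_of_mem (u := A) (hsN n hn))
  simp only [measureReal_restrict_apply, hAm, hEm, (hAm _).inter (hAm _)] at hsq
  have hlower : S * ρ / R ≤ ∑ n ∈ s, volume.real (A n ∩ closedBall c ρ) := by
    rw [Finset.sum_mul, Finset.sum_div]
    refine Finset.sum_le_sum fun n hn => ?_
    have hpos : 0 < |α ^ n| := by positivity
    rw [volume_preimage_fattening_inter_closedBall (pow_ne_zero n hα0),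
      ← div_eq_inv_mul, le_div_iff₀ hpos]
    refine le_trans (le_of_eq ?_) (le_volume_fattening_inter_closedBall hr hR hpack hcov (h0 n)
      (hψr n) (α ^ n * c) (ρ := |α ^ n| * ρ) (by rw [abs_pow]; exact hsl n hn))
    ring
  set g : ℕ → ℕ → ℝ := fun m n => if m ≤ n then ψ n * |α|⁻¹ ^ (n - m) else 0
  have hg : ∀ m n, 0 ≤ g m n := fun m n => by
    simp only [g]
    split_ifs
    · exact mul_nonneg (h0 n) (pow_nonneg hq0 _)
    · exact le_rfl
  have hpair : ∀ m ∈ s, ∀ n ∈ s, volume.real (A m ∩ A n ∩ closedBall c ρ) ≤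
      4 * ρ / r * (ψ m * ψ n / r + 2 * (g m n + g n m)) := by
    have aux : ∀ m ∈ s, ∀ n, m ≤ n → volume.real (A m ∩ A n ∩ closedBall c ρ) ≤
        4 * ρ / r * (ψ m * ψ n / r + 2 * (g m n + g n m)) := by
      intro m hm n hmn
      refine (volume_inter_approx_le hr hpack h0 hψr hα c hmn
        (by linarith [hsl m hm])).trans ?_
      have : g m n = ψ n * |α|⁻¹ ^ (n - m) := if_pos hmn
      rw [← this]
      gcongr
      linarith [hg n m]
    intro m hm n hn
    rcases le_total m n with hmn | hnm
    · exact aux m hm n hmn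
    · rw [inter_comm (A m), mul_comm (ψ m), add_comm (g m n)]
      exact aux n hn m hnm
  have hgs : ∑ n ∈ s, ∑ m ∈ s, g m n ≤ D * S := sum_sum_mul_pow_sub_le hq0 hq s h0
  have hupper : ∑ m ∈ s, ∑ n ∈ s, volume.real (A m ∩ A n ∩ closedBall c ρ) ≤
      ρ * (4 / r * (1 / r + 4 * D)) * S ^ 2 := by
    calc _ ≤ ∑ m ∈ s, ∑ n ∈ s, 4 * ρ / r * (ψ m * ψ n / r + 2 * (g m n + g n m)) :=
          Finset.sum_le_sum fun m hm => Finset.sum_le_sum fun n hn => hpair m hm n hn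
      _ = 4 * ρ / r * (S * S / r + 2 * (∑ n ∈ s, ∑ m ∈ s, g m n + ∑ n ∈ s, ∑ m ∈ s, g m n)) := by
          simp only [← Finset.mul_sum, Finset.sum_add_distrib, ← Finset.sum_div]
          rw [Finset.sum_comm (f := fun m n => g m n), ← Finset.sum_mul]
      _ ≤ 4 * ρ / r * (S * S / r + 2 * (D * S * S + D * S * S)) := by
          have : D * S ≤ D * S * S := le_mul_of_one_le_right (by positivity) hM
          gcongr <;> linarith
      _ = _ := by ring
  have hS : 0 < S := by linarith
  have hK : 0 < 4 / r * (1 / r + 4 * D) := by positivity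
  set K := 4 / r * (1 / r + 4 * D)
  have hfin : (S * ρ / R) ^ 2 ≤
      volume.real (E ∩ closedBall c ρ) * (ρ * K * S ^ 2) :=
    (pow_le_pow_left₀ (by positivity) hlower 2).trans
      (hsq.trans (mul_le_mul_of_nonneg_left hupper measureReal_nonneg))
  rw [← div_le_iff₀ (by positivity)] at hfin
  refine le_trans (le_of_eq ?_) hfin
  field_simp

/-- Khintchine divergence for Delone sets along `α ^ n`, for any real `α` with `|α| > 1`. -/
theorem delone_khintchine_divergence_of_one_lt_abs (hr : 0 < r) (hR : 0 < R)
    (hpack : ∀ y ∈ Y, ∀ y' ∈ Y, y ≠ y' → 2 * r ≤ |y - y'|)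
    (hcov : ∀ x : ℝ, ∃ y ∈ Y, |x - y| ≤ R)
    (hψ : ∀ n, 0 ≤ ψ n) (hα : 1 < |α|) (hdiv : ¬ Summable ψ) :
    ∀ᵐ x : ℝ, {p : ℕ × ℝ | p.2 ∈ Y ∧ |α ^ p.1 * x - p.2| ≤ ψ p.1}.Infinite := by
  have hq : |α|⁻¹ < 1 := inv_lt_one_of_one_lt₀ hα
  have hD : 0 < (1 - |α|⁻¹)⁻¹ := inv_pos.2 (by linarith)
  have hall : ∀ N : ℕ, ∀ᵐ x : ℝ,
      x ∈ ⋃ n ≥ N, (fun x => α ^ n * x) ⁻¹' fattening Y (min (ψ n) (r / 2)) := by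
    intro N
    refine ae_mem_of_forall_le_volume_inter_closedBall
      (MeasurableSet.iUnion fun n => MeasurableSet.iUnion fun _ =>
        (measurableSet_fattening (countable_of_separated hr hpack) _).preimage
          (measurable_const_mul _))
      (κ := (R ^ 2 * (4 / r * (1 / r + 4 * (1 - |α|⁻¹)⁻¹)))⁻¹) (by positivity) fun c ρ hρ => ?_
    exact le_volume_iUnion_approx_inter (ψ := fun n => min (ψ n) (r / 2)) hr hR hpack hcov
      (fun n => le_min (hψ n) (by positivity))
      (fun n => (min_le_right _ _).trans_lt (by linarith)) hα
      (not_summable_min hdiv (by positivity)) N c hρ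
  filter_upwards [ae_all_iff.2 hall] with x hx
  refine Infinite.of_image Prod.fst (Set.infinite_of_forall_exists_gt fun N => ?_)
  obtain ⟨n, hn, hxn⟩ := mem_iUnion₂.1 (hx (N + 1))
  obtain ⟨y, hy, hxy⟩ := mem_fattening.1 hxn
  exact ⟨n, ⟨(n, y), ⟨hy, hxy.trans (min_le_left _ _)⟩, rfl⟩, hn⟩

end Delone

/-- The case `α < -1` of the divergence half of the main theorem. -/
theorem delone_khintchine_divergence_neg
    (Y : Set ℝ) (r R : ℝ) (hr : 0 < r) (hR : 0 < R)
    (hpack : ∀ y ∈ Y, ∀ y' ∈ Y, y ≠ y' → 2 * r ≤ |y - y'|)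
    (hcov : ∀ x : ℝ, ∃ y ∈ Y, |x - y| ≤ R)
    (ψ : ℕ → ℝ) (hψ : ∀ n, 0 ≤ ψ n)
    (α : ℝ) (hα : α < -1)
    (hdiv : ¬ Summable ψ) :
    ∀ᵐ x : ℝ, {p : ℕ × ℝ | p.2 ∈ Y ∧ |α ^ p.1 * x - p.2| ≤ ψ p.1}.Infinite :=
  delone_khintchine_divergence_of_one_lt_abs hr hR hpack hcov hψ
    (lt_abs.2 (Or.inr (by linarith))) hdiv
end

section
/- Let Y be a Delone set in ℝ with packing radius r > 0 and covering radius R > 0, let 0 ≤ a < b, let α > 1 be real, let J be a positive integer with α^J ≥ 2R(1 + 2/r)/r + 1, let j ∈ {0,…,J−1}, and set β = α^J. For each n ∈ ℕ let Y^(n) = Y \ ⋃_{m=1}^{n−1} B(β^{n−m} Y, 1), and define 𝒜'_n = {x ∈ [a,b) : |α^j β^n x − y| ≤ ψ(nJ+j) for some y ∈ Y^(n)}, where ψ : ℕ → [0,∞). Then there exists a constant C > 0 depending only on r and R, and an N ∈ ℕ (depending on a, b), such that for all m, n ≥ N with m ≠ n, λ(𝒜'_m ∩ 𝒜'_n) ≤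 C (b−a) ψ(mJ+j) ψ(nJ+j). -/
open MeasureTheory Set

/-- A set of reals whose distinct points are at distance at least `2 * r`. -/
def IsSeparatedBy (r : ℝ) (S : Set ℝ) : Prop :=
  ∀ y ∈ S, ∀ y' ∈ S, y ≠ y' → 2 * r ≤ |y - y'|

lemma IsSeparatedBy.mono {r : ℝ} {S T : Set ℝ} (hT : IsSeparatedBy r T) (hST : S ⊆ T) :
    IsSeparatedBy r S :=
  fun y hy y' hy' h => hT y (hST hy) y' (hST hy') h

/-- The points of `[a, b)` whose dilate by `P` lies within `t` of a point of `S`. -/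
def approxSet (S : Set ℝ) (a b P t : ℝ) : Set ℝ :=
  {x | x ∈ Ico a b ∧ ∃ y ∈ S, |P * x - y| ≤ t}

lemma IsSeparatedBy.finite_and_ncard_le {r u v : ℝ} {S : Set ℝ} (hS : IsSeparatedBy r S)
    (hr : 0 < r) (huv : u ≤ v) (hsub : S ⊆ Icc u v) :
    S.Finite ∧ (S.ncard : ℝ) ≤ (v - u) / (2 * r) + 1 := by
  have hmaps : MapsTo (fun y : ℝ => ⌊(y - u) / (2 * r)⌋₊) S
      (Finset.range (⌊(v - u) / (2 * r)⌋₊ + 1) : Finset ℕ) := by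
    intro y hy
    simp only [Finset.coe_range, mem_Iio, Nat.lt_succ_iff]
    apply Nat.floor_le_floor
    have := (hsub hy).2
    gcongr
  have hinj : InjOn (fun y : ℝ => ⌊(y - u) / (2 * r)⌋₊) S := by
    intro y hy z hz hyz
    by_contra hne
    have hsep := hS y hy z hz hne
    have hy0 : 0 ≤ (y - u) / (2 * r) := div_nonneg (by linarith [(hsub hy).1]) (by linarith)
    have hz0 : 0 ≤ (z - u) / (2 * r) := div_nonneg (by linarith [(hsub hz).1]) (by linarith)
    have hy1 := Nat.floor_le hy0
    have hy2 := Nat.lt_floor_add_one ((y - u) / (2 * r))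
    have hz1 := Nat.floor_le hz0
    have hz2 := Nat.lt_floor_add_one ((z - u) / (2 * r))
    simp only at hyz
    rw [hyz] at hy1 hy2
    have hlt : |(y - u) / (2 * r) - (z - u) / (2 * r)| < 1 := by
      rw [abs_lt]; constructor <;> linarith
    rw [← sub_div, sub_sub_sub_cancel_right, abs_div, abs_of_pos (by linarith : 0 < 2 * r),
      div_lt_one (by linarith)] at hlt
    linarith
  refine ⟨Finite.of_injOn hmaps hinj (Finset.finite_toSet _), ?_⟩
  have hcard := ncard_le_ncard_of_injOn _ hmaps hinj (Finset.finite_toSet _)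
  rw [ncard_coe_finset, Finset.card_range] at hcard
  have hfloor := Nat.floor_le (div_nonneg (sub_nonneg.2 huv) (by linarith : 0 ≤ 2 * r))
  have : (S.ncard : ℝ) ≤ (⌊(v - u) / (2 * r)⌋₊ : ℝ) + 1 := by exact_mod_cast hcard
  linarith

lemma IsSeparatedBy.volume_biUnion_le {r u v c : ℝ} {S : Set ℝ} (hS : IsSeparatedBy r S)
    (hr : 0 < r) (huv : u ≤ v) (hsub : S ⊆ Icc u v) (hc : 0 ≤ c) {E : ℝ → Set ℝ}
    (hE : ∀ y ∈ S, volume (E y) ≤ ENNReal.ofReal c) :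
    volume (⋃ y ∈ S, E y) ≤ ENNReal.ofReal (((v - u) / (2 * r) + 1) * c) := by
  obtain ⟨hfin, hcard⟩ := hS.finite_and_ncard_le hr huv hsub
  lift S to Finset ℝ using hfin
  rw [ncard_coe_finset] at hcard
  calc volume (⋃ y ∈ (S : Set ℝ), E y) ≤ ∑ y ∈ S, volume (E y) := by
        simpa using measure_biUnion_finset_le S E
    _ ≤ ∑ _y ∈ S, ENNReal.ofReal c := Finset.sum_le_sum fun y hy => hE y hy
    _ = ENNReal.ofReal (S.card * c) := by
        rw [Finset.sum_const, nsmul_eq_mul, ENNReal.ofReal_mul (by positivity),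
          ENNReal.ofReal_natCast]
    _ ≤ _ := ENNReal.ofReal_le_ofReal (by gcongr)

lemma volume_abs_mul_sub_le {P : ℝ} (hP : 0 < P) (y t : ℝ) :
    volume {x : ℝ | |P * x - y| ≤ t} ≤ ENNReal.ofReal (2 * t / P) := by
  have hsub : {x : ℝ | |P * x - y| ≤ t} ⊆ Icc ((y - t) / P) ((y + t) / P) := by
    intro x hx
    obtain ⟨h1, h2⟩ := abs_le.1 (mem_ofPred.1 hx)
    rw [mem_Icc, div_le_iff₀ hP, le_div_iff₀ hP]
    constructor <;> linarith
  refine (measure_mono hsub).trans ?_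
  rw [Real.volume_Icc, ← sub_div]
  exact ENNReal.ofReal_le_ofReal (le_of_eq (by ring))

/-- A union over the points of a separated set that are relevant for `[a, b)` at scale `P`
has measure at most a constant times `P * (b - a)` times the measure of a single piece. -/
lemma IsSeparatedBy.volume_approx_le {r a b P t c : ℝ} {S : Set ℝ} (hS : IsSeparatedBy r S)
    (hr : 0 < r) (hP : 0 < P) (hPab : 1 ≤ P * (b - a)) (ht : t ≤ 1) (hc : 0 ≤ c)
    {E : ℝ → Set ℝ} (hE : ∀ y ∈ S, volume (E y) ≤ ENNReal.ofReal c) :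
    volume {x | x ∈ Ico a b ∧ ∃ y ∈ S, |P * x - y| ≤ t ∧ x ∈ E y} ≤
      ENNReal.ofReal ((3 / (2 * r) + 1) * (P * (b - a)) * c) := by
  have hsub : {x | x ∈ Ico a b ∧ ∃ y ∈ S, |P * x - y| ≤ t ∧ x ∈ E y} ⊆
      ⋃ y ∈ S ∩ Icc (P * a - 1) (P * b + 1), E y := by
    rintro x ⟨⟨hxa, hxb⟩, y, hy, hxy, hxE⟩
    obtain ⟨h1, h2⟩ := abs_le.1 hxy
    have h3 := mul_le_mul_of_nonneg_left hxa hP.le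
    have h4 := mul_le_mul_of_nonneg_left hxb.le hP.le
    simp only [mem_iUnion]
    exact ⟨y, ⟨hy, by linarith, by linarith⟩, hxE⟩
  refine (measure_mono hsub).trans <| ((hS.mono inter_subset_left).volume_biUnion_le hr
    (by linarith) inter_subset_right hc fun y hy => hE y hy.1).trans <|
    ENNReal.ofReal_le_ofReal ?_
  gcongr
  calc (P * b + 1 - (P * a - 1)) / (2 * r) + 1 = (P * (b - a) + 2) / (2 * r) + 1 := by ring
    _ ≤ (3 * (P * (b - a))) / (2 * r) + P * (b - a) := by gcongr; linarith
    _ = _ := by ring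

lemma IsSeparatedBy.volume_approxSet_le {r a b P t : ℝ} {S : Set ℝ} (hS : IsSeparatedBy r S)
    (hr : 0 < r) (hP : 0 < P) (hPab : 1 ≤ P * (b - a)) (ht0 : 0 ≤ t) (ht : t ≤ 1) :
    volume (approxSet S a b P t) ≤
      ENNReal.ofReal (2 * (3 / (2 * r) + 1) * (b - a) * t) := by
  have h := hS.volume_approx_le hr hP hPab ht (c := 2 * t / P) (by positivity)
    (E := fun y => {x | |P * x - y| ≤ t}) fun y _ => volume_abs_mul_sub_le hP y t
  simp only [mem_ofPred_eq, and_self] at h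
  refine h.trans (ENNReal.ofReal_le_ofReal (le_of_eq ?_))
  field_simp

/-- The overlap with the `s`-approximation set of `T` at scale `B * P` of a single interval of
the `t`-approximation set at scale `P`, when its centre `y` satisfies `1 < |z - B * y|` for all
`z ∈ T`. -/
lemma IsSeparatedBy.volume_overlap_le {r P B t s y : ℝ} {T : Set ℝ} (hT : IsSeparatedBy r T)
    (hr : 0 < r) (hP : 0 < P) (hB : 0 < B) (ht : 0 ≤ t) (hs : 0 ≤ s)
    (hfar : ∀ z ∈ T, 1 < |z - B * y|) :
    volume {x | |P * x - y| ≤ t ∧ ∃ z ∈ T, |B * P * x - z| ≤ s} ≤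
      ENNReal.ofReal (4 * (1 / r + 1) * (t * s) / P) := by
  have hclose : ∀ x z, |P * x - y| ≤ t → |B * P * x - z| ≤ s → |z - B * y| ≤ s + B * t := by
    intro x z hxy hxz
    calc |z - B * y| = |B * (P * x - y) - (B * P * x - z)| := by congr 1; ring
      _ ≤ |B * (P * x - y)| + |B * P * x - z| := abs_sub _ _
      _ ≤ B * t + s := by rw [abs_mul, abs_of_pos hB]; gcongr
      _ = s + B * t := add_comm _ _
  rcases le_or_gt (s + B * t) 1 with hsmall | hbig
  · have hempty : {x | |P * x - y| ≤ t ∧ ∃ z ∈ T, |B * P * x - z| ≤ s} = ∅ := by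
      refine eq_empty_of_forall_notMem ?_
      rintro x ⟨hxy, z, hz, hxz⟩
      linarith [hfar z hz, hclose x z hxy hxz]
    simp [hempty]
  have hBP : 0 < B * P := mul_pos hB hP
  have hsub : {x | |P * x - y| ≤ t ∧ ∃ z ∈ T, |B * P * x - z| ≤ s} ⊆
      ⋃ z ∈ T ∩ Icc (B * y - (s + B * t)) (B * y + (s + B * t)),
        {x | |P * x - y| ≤ t} ∩ {x | |B * P * x - z| ≤ s} := by
    rintro x ⟨hxy, z, hz, hxz⟩
    obtain ⟨h1, h2⟩ := abs_le.1 (hclose x z hxy hxz)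
    simp only [mem_iUnion]
    exact ⟨z, ⟨hz, by linarith, by linarith⟩, hxy, hxz⟩
  have hpiece : ∀ z, volume ({x | |P * x - y| ≤ t} ∩ {x | |B * P * x - z| ≤ s}) ≤
      ENNReal.ofReal (min (2 * t / P) (2 * s / (B * P))) := by
    intro z
    rw [ENNReal.ofReal_min]
    exact le_min ((measure_mono inter_subset_left).trans (volume_abs_mul_sub_le hP y t))
      ((measure_mono inter_subset_right).trans (volume_abs_mul_sub_le hBP z s))
  have hmin : (s + B * t) * min (2 * t / P) (2 * s / (B * P)) ≤ 4 * (t * s) / P := by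
    rcases le_total s (B * t) with h | h
    · calc (s + B * t) * min (2 * t / P) (2 * s / (B * P))
          ≤ (B * t + B * t) * (2 * s / (B * P)) := by gcongr; exact min_le_right _ _
        _ = 4 * (t * s) / P := by field_simp; ring
    · calc (s + B * t) * min (2 * t / P) (2 * s / (B * P))
          ≤ (s + s) * (2 * t / P) := by gcongr; exact min_le_left _ _
        _ = 4 * (t * s) / P := by ring
  have hmin0 : 0 ≤ min (2 * t / P) (2 * s / (B * P)) := le_min (by positivity) (by positivity)
  refine (measure_mono hsub).trans <| ((hT.mono inter_subset_left).volume_biUnion_le hr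
    (by linarith) inter_subset_right hmin0 fun z _ => hpiece z).trans <|
    ENNReal.ofReal_le_ofReal ?_
  calc ((B * y + (s + B * t) - (B * y - (s + B * t))) / (2 * r) + 1) *
        min (2 * t / P) (2 * s / (B * P))
      = ((s + B * t) / r + 1) * min (2 * t / P) (2 * s / (B * P)) := by
        congr 2; field_simp; ring
    _ ≤ ((s + B * t) / r + (s + B * t)) * min (2 * t / P) (2 * s / (B * P)) := by gcongr
    _ = (1 / r + 1) * ((s + B * t) * min (2 * t / P) (2 * s / (B * P))) := by ring
    _ ≤ (1 / r + 1) * (4 * (t * s) / P) := by gcongr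
    _ = _ := by ring

/-- Quasi-independence of the approximation sets of two separated sets at scales `P` and
`B * P` when `T` avoids the unit neighbourhood of `B * S`. -/
lemma volume_approxSet_inter_le {r a b P B t s : ℝ} {S T : Set ℝ} (hS : IsSeparatedBy r S)
    (hT : IsSeparatedBy r T) (hr : 0 < r) (hab : a < b) (hP : 0 < P) (hB : 1 ≤ B)
    (hPab : 1 ≤ P * (b - a)) (ht : 0 ≤ t) (hs : 0 ≤ s)
    (hfar : ∀ y ∈ S, ∀ z ∈ T, 1 < |z - B * y|) :
    volume (approxSet S a b P t ∩ approxSet T a b (B * P) s) ≤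
      ENNReal.ofReal (4 * (3 / (2 * r) + 1) * (1 / r + 1) * (b - a) * t * s) := by
  have hab' : 0 < b - a := sub_pos.2 hab
  have hB0 : 0 < B := by linarith
  have hr1 : 0 < 1 / r := by positivity
  have hr2 : 0 < 3 / (2 * r) := by positivity
  have hC : 2 * (3 / (2 * r) + 1) ≤ 4 * (3 / (2 * r) + 1) * (1 / r + 1) := by nlinarith
  rcases le_or_gt t 1 with ht1 | ht1
  · rcases le_or_gt s 1 with hs1 | hs1
    · have h := hS.volume_approx_le hr hP hPab ht1
        (c := 4 * (1 / r + 1) * (t * s) / P) (by positivity)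
        (E := fun y => {x | |P * x - y| ≤ t ∧ ∃ z ∈ T, |B * P * x - z| ≤ s})
        fun y hy => hT.volume_overlap_le hr hP hB0 ht hs (hfar y hy)
      refine (measure_mono ?_).trans (h.trans (ENNReal.ofReal_le_ofReal (le_of_eq ?_)))
      · rintro x ⟨⟨hx, y, hy, hxy⟩, -, hz⟩
        exact ⟨hx, y, hy, hxy, hxy, hz⟩
      · field_simp
    · refine (measure_mono inter_subset_left).trans <|
        (hS.volume_approxSet_le hr hP hPab ht ht1).trans (ENNReal.ofReal_le_ofReal ?_)
      calc 2 * (3 / (2 * r) + 1) * (b - a) * t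
          ≤ 4 * (3 / (2 * r) + 1) * (1 / r + 1) * (b - a) * t * 1 := by rw [mul_one]; gcongr
        _ ≤ _ := by gcongr
  · rcases le_or_gt s 1 with hs1 | hs1
    · have hBPab : 1 ≤ B * P * (b - a) := by
        rw [mul_assoc]; exact one_le_mul_of_one_le_of_one_le hB hPab
      refine (measure_mono inter_subset_right).trans <|
        (hT.volume_approxSet_le hr (mul_pos hB0 hP) hBPab hs hs1).trans
          (ENNReal.ofReal_le_ofReal ?_)
      calc 2 * (3 / (2 * r) + 1) * (b - a) * s
          ≤ 4 * (3 / (2 * r) + 1) * (1 / r + 1) * (b - a) * 1 * s := by rw [mul_one]; gcongr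
        _ ≤ _ := by gcongr
    · have hsub : approxSet S a b P t ∩ approxSet T a b (B * P) s ⊆ Ico a b :=
        fun x hx => hx.1.1
      refine (measure_mono hsub).trans ?_
      rw [Real.volume_Ico]
      refine ENNReal.ofReal_le_ofReal ?_
      calc b - a = 1 * (b - a) * 1 * 1 := by ring
        _ ≤ _ := by
          gcongr
          linarith

/-- For every `r, R > 0` there is a constant `C > 0` (depending only on `r` and `R`)
such that, in the setup of the paper, for all sufficiently large `m ≠ n` one has
`λ(𝒜'_m ∩ 𝒜'_n) ≤ C (b-a) ψ(mJ+j) ψ(nJ+j)`. -/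
theorem measure_pruned_approx_sets_quasi_independent
    (r R : ℝ) (hr : 0 < r) (hR : 0 < R) :
    ∃ C : ℝ, 0 < C ∧
      ∀ (Y : Set ℝ),
        (∀ y ∈ Y, ∀ y' ∈ Y, y ≠ y' → 2 * r ≤ |y - y'|) →
        (∀ x : ℝ, ∃ y ∈ Y, |x - y| ≤ R) →
        ∀ (a b : ℝ), 0 ≤ a → a < b →
        ∀ (α : ℝ), 1 < α →
        ∀ (J : ℕ), 0 < J → 2 * R * (1 + 2 / r) / r + 1 ≤ α ^ J →
        ∀ j < J,
        ∀ (ψ : ℕ → ℝ), (∀ n, 0 ≤ ψ n) →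
        ∀ (Yn : ℕ → Set ℝ),
          (∀ n : ℕ, Yn n =
            Y \ ⋃ m ∈ Finset.Ico 1 n,
              {x : ℝ | ∃ y ∈ Y, |x - (α ^ J) ^ (n - m) * y| ≤ 1}) →
        ∃ N : ℕ, ∀ m ≥ N, ∀ n ≥ N, m ≠ n →
          volume ({x | x ∈ Ico a b ∧
                ∃ y ∈ Yn m, |α ^ j * (α ^ J) ^ m * x - y| ≤ ψ (m * J + j)} ∩
              {x | x ∈ Ico a b ∧
                ∃ y ∈ Yn n, |α ^ j * (α ^ J) ^ n * x - y| ≤ ψ (n * J + j)})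
            ≤ ENNReal.ofReal (C * (b - a) * ψ (m * J + j) * ψ (n * J + j)) := by
  refine ⟨4 * (3 / (2 * r) + 1) * (1 / r + 1), by positivity, ?_⟩
  intro Y hY _ a b _ hab α hα J hJ _ j _ ψ hψ Yn hYn
  have hβ : 1 < α ^ J := one_lt_pow₀ hα hJ.ne'
  obtain ⟨k, hk⟩ := pow_unbounded_of_one_lt (1 / (b - a)) hβ
  have hab' : 0 < b - a := sub_pos.2 hab
  have hsep : ∀ n, IsSeparatedBy r (Yn n) := fun n =>
    IsSeparatedBy.mono (T := Y) hY (by rw [hYn]; exact sdiff_subset)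
  have key : ∀ m n, k + 1 ≤ m → m < n →
      volume (approxSet (Yn m) a b (α ^ j * (α ^ J) ^ m) (ψ (m * J + j)) ∩
        approxSet (Yn n) a b (α ^ j * (α ^ J) ^ n) (ψ (n * J + j))) ≤
      ENNReal.ofReal (4 * (3 / (2 * r) + 1) * (1 / r + 1) * (b - a) *
        ψ (m * J + j) * ψ (n * J + j)) := by
    intro m n hm hmn
    have hscale : α ^ j * (α ^ J) ^ n = (α ^ J) ^ (n - m) * (α ^ j * (α ^ J) ^ m) := by
      rw [mul_left_comm, ← pow_add, Nat.sub_add_cancel hmn.le]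
    have hlarge : (α ^ J) ^ k ≤ α ^ j * (α ^ J) ^ m :=
      (pow_le_pow_right₀ hβ.le (by omega)).trans
        (le_mul_of_one_le_left (by positivity) (one_le_pow₀ hα.le))
    rw [hscale]
    refine volume_approxSet_inter_le (hsep m) (hsep n) hr hab (by positivity)
      (one_le_pow₀ hβ.le) ?_ (hψ _) (hψ _) ?_
    · rw [← div_le_iff₀ hab']
      exact hk.le.trans hlarge
    · intro y hy z hz
      rw [hYn] at hy hz
      by_contra! hle
      refine hz.2 ?_
      simp only [mem_iUnion, Finset.mem_Ico]
      exact ⟨m, ⟨by omega, hmn⟩, y, hy.1, hle⟩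
  refine ⟨k + 1, fun m hm n hn hmn => ?_⟩
  rcases lt_or_gt_of_ne hmn with h | h
  · exact key m n hm h
  · rw [inter_comm, mul_right_comm]
    exact key n m hn h
end
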